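/- arXiv:1202.2781 — 4 statements merged into one kernel-verified Lean document; each statement's English description precedes it below -/
import Mathlib

section
/- Let p be a prime, k a finite field extension of ℚ_p, and K a field extension of k. Let Ō be a valuation subring of K̄ with k ⊆ Ō such that the valuation subring O = Ō ∩ K of K has residue field k. Then there exists a birational Galois section s : Gal_k → Gal_K with s(Gal_k) contained in the decomposition subgroup D_Ō; equivalently, the restriction homomorphism res_{K/k}, restricted to D_Ō, is surjective onto Gal_k and admits a continuous group-theoretic splitting. In particular the packet of sections associated to such a k-valuation is nonempty. -/
/-!
Packets are nonempty: for a `k`-valuation `Ō` of `K̄` whose restriction to `K` has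
residue field `k`, the projection `D_Ō → Gal_k` splits; i.e. there is a birational
Galois section with image inside the decomposition subgroup `D_Ō`.
-/

/-- The restriction homomorphism `Gal(Kbar/F) →* Gal(kbar/k)`, where
`kbar = algebraicClosure k Kbar` is the relative algebraic closure of `k` in `Kbar`. -/
noncomputable def resHom (k F Kbar : Type*) [Field k] [Field F] [Field Kbar]
    [Algebra k F] [Algebra F Kbar] [Algebra k Kbar] [IsScalarTower k F Kbar]
    [IsAlgClosed Kbar] :
    (Kbar ≃ₐ[F] Kbar) →* ((algebraicClosure k Kbar) ≃ₐ[k] (algebraicClosure k Kbar)) :=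
  (AlgEquiv.restrictNormalHom (F := k) (K₁ := Kbar) (algebraicClosure k Kbar)).comp
    { toFun := fun σ => σ.restrictScalars k
      map_one' := rfl
      map_mul' := fun _ _ => rfl }

/-- The composite `k → O → O/m_O` from `k` to the residue field of a valuation subring `O`
of a field extension `K` of `k` containing (the image of) `k`. -/
noncomputable def residueEmbed {k K : Type*} [Field k] [Field K] [Algebra k K]
    (O : ValuationSubring K) (h : ∀ a : k, algebraMap k K a ∈ O) :
    k → IsLocalRing.ResidueField O :=
  fun a => IsLocalRing.residue O ⟨algebraMap k K a, h a⟩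

/-- Every element of a field is a quotient `(x * s) / s` where `s = (x ^ 2 + c)⁻¹`; for a suitable
`c : ℕ`, both `s` and `x * s` are integral at each of finitely many places, and `s` is a unit
exactly at those places where `x` is integral. -/
theorem Valuation.exists_common_denominator {M Γ ι : Type*} [Field M] [Finite ι]
    [LinearOrderedCommGroupWithZero Γ] (w : ι → Valuation M Γ)
    (hw : ∀ i (n : ℕ), n ≠ 0 → w i n = 1) (x : M) :
    ∃ c : ℕ, ∀ i, w i (x ^ 2 + c)⁻¹ ≤ 1 ∧ w i (x * (x ^ 2 + c)⁻¹) ≤ 1 ∧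
      (w i x ≤ 1 → w i (x ^ 2 + c)⁻¹ = 1) ∧ (1 < w i x → w i (x ^ 2 + c)⁻¹ < 1) := by
  classical
  have hle : ∀ i (n : ℕ), w i n ≤ 1 := fun i n ↦ by
    rcases eq_or_ne n 0 with rfl | hn
    · simp
    · exact (hw i n hn).le
  let B : ι → Set ℕ := fun i ↦ {c | w i (x ^ 2 + c) < 1}
  have hB : ∀ i, (B i).Subsingleton := by
    intro i c hc d hd
    by_contra hcd
    wlog hlt : c < d generalizing c d
    · exact this hd hc (Ne.symm hcd) (by omega)
    have h1 : w i ((x ^ 2 + d) - (x ^ 2 + c)) < 1 := (w i).map_sub_lt hd hc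
    have h2 : (x ^ 2 + d) - (x ^ 2 + c) = ((d - c : ℕ) : M) := by
      rw [Nat.cast_sub hlt.le]; ring
    rw [h2, hw i _ (by omega)] at h1
    exact lt_irrefl _ h1
  have hfin : (⋃ i, B i).Finite := Set.finite_iUnion fun i ↦ (hB i).finite
  obtain ⟨c, hc⟩ := hfin.exists_notMem
  refine ⟨c, fun i ↦ ?_⟩
  have hci : 1 ≤ w i (x ^ 2 + c) := by
    by_contra h
    exact hc (Set.mem_iUnion.2 ⟨i, not_le.1 h⟩)
  have hint : w i x ≤ 1 → w i (x ^ 2 + c) = 1 := fun h ↦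
    le_antisymm ((w i).map_add_le (by rw [map_pow]; exact pow_le_one₀ zero_le h) (hle i c)) hci
  have hbig : 1 < w i x → w i (x ^ 2 + c) = w i x ^ 2 := fun h ↦ by
    rw [(w i).map_add_eq_of_lt_left, map_pow]
    rw [map_pow]
    exact (hle i c).trans_lt (one_lt_pow₀ h two_ne_zero)
  have hlt : 1 < w i x → w i (x ^ 2 + c)⁻¹ < 1 := fun h ↦ by
    rw [map_inv₀, hbig h]
    exact inv_lt_one_of_one_lt₀ (one_lt_pow₀ h two_ne_zero)
  refine ⟨?_, ?_, fun h ↦ by rw [map_inv₀, hint h, inv_one], hlt⟩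
  · rw [map_inv₀]
    exact inv_le_one_of_one_le₀ hci
  · rcases le_or_gt (w i x) 1 with h | h
    · rw [map_mul, map_inv₀, hint h, inv_one, mul_one]; exact h
    · have h0 : w i x ≠ 0 := (zero_lt_one.trans h).ne'
      rw [map_mul, map_inv₀, hbig h, pow_two, mul_inv, ← mul_assoc, mul_inv_cancel₀ h0, one_mul]
      exact (inv_lt_one_of_one_lt₀ h).le

/-- The decomposition group of a valuation in a finite group of automorphisms. -/
def Valuation.decompositionGroup (K : Type*) {M Γ : Type*} [Field K] [Field M] [Algebra K M]
    [FiniteDimensional K M] [LinearOrderedCommGroupWithZero Γ] (v : Valuation M Γ) :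
    Subgroup (M ≃ₐ[K] M) where
  carrier := {σ | ∀ x, v x ≤ 1 → v (σ x) ≤ 1}
  one_mem' := fun _ h ↦ h
  mul_mem' := fun hσ hτ x h ↦ hσ _ (hτ x h)
  inv_mem' := by
    intro σ hσ x hx
    have hpow : ∀ n : ℕ, v ((σ ^ n) x) ≤ 1 := fun n ↦ by
      induction n with
      | zero => simpa using hx
      | succ n ih => rw [pow_succ']; exact hσ _ ih
    obtain ⟨n, hn⟩ := (mem_powers_iff_mem_zpowers (x := σ) (y := σ⁻¹)).2
      (Subgroup.inv_mem _ (Subgroup.mem_zpowers σ))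
    have := hpow n
    simp only at hn
    rwa [hn] at this

theorem Valuation.mem_decompositionGroup {K M Γ : Type*} [Field K] [Field M] [Algebra K M]
    [FiniteDimensional K M] [LinearOrderedCommGroupWithZero Γ] {v : Valuation M Γ}
    {σ : M ≃ₐ[K] M} :
    σ ∈ v.decompositionGroup K ↔ ∀ x, v x ≤ 1 → v (σ x) ≤ 1 := Iff.rfl

/-- An element which is fixed by the decomposition group of `v`, is a unit for `v`, and lies in
the maximal ideals of all other conjugates of `v`. -/
theorem Valuation.exists_isolating_element {K M Γ : Type*} [Field K] [Field M] [Algebra K M]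
    [FiniteDimensional K M] [LinearOrderedCommGroupWithZero Γ] (v : Valuation M Γ)
    (hv : ∀ n : ℕ, n ≠ 0 → v n = 1) :
    ∃ e ∈ IntermediateField.fixedField (v.decompositionGroup K), v e = 1 ∧
      ∀ σ : M ≃ₐ[K] M, v (σ e) ≤ 1 ∧ (σ ∉ v.decompositionGroup K → v (σ e) < 1) := by
  classical
  set D := v.decompositionGroup K with hD
  have hDv : ∀ σ ∈ D, ∀ x, v x ≤ 1 → v (σ x) ≤ 1 := fun σ hσ ↦ mem_decompositionGroup.1 hσ
  let w : (M ≃ₐ[K] M) → Valuation M Γ := fun σ ↦ v.comap (σ : M →+* M)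
  have hw : ∀ σ (n : ℕ), n ≠ 0 → w σ n = 1 := fun σ n hn ↦ by simp [w, hv n hn]
  have key : ∀ τ : M ≃ₐ[K] M, ∃ e : M, v e = 1 ∧ (∀ σ : M ≃ₐ[K] M, v (σ e) ≤ 1) ∧
      (τ ∉ D → v (τ e) < 1) := by
    intro τ
    by_cases hτ : τ ∈ D
    · exact ⟨1, by simp, by simp, fun h ↦ absurd hτ h⟩
    · rw [hD, mem_decompositionGroup] at hτ
      push Not at hτ
      obtain ⟨x, hx, hx'⟩ := hτ
      obtain ⟨c, hc⟩ := exists_common_denominator w hw x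
      exact ⟨(x ^ 2 + c)⁻¹, (hc 1).2.2.1 hx, fun σ ↦ (hc σ).1, fun _ ↦ (hc τ).2.2.2 hx'⟩
  choose e he1 he2 he3 using key
  obtain ⟨f, hf1, hf2, hf3⟩ : ∃ f : M, v f = 1 ∧ (∀ σ : M ≃ₐ[K] M, v (σ f) ≤ 1) ∧
      ∀ σ : M ≃ₐ[K] M, σ ∉ D → v (σ f) < 1 := by
    refine ⟨∏ τ, e τ, ?_, fun σ ↦ ?_, fun σ hσ ↦ ?_⟩
    · rw [map_prod]; exact Finset.prod_eq_one fun τ _ ↦ he1 τ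
    · rw [map_prod, map_prod]; exact Finset.prod_le_one' fun τ _ ↦ he2 τ σ
    · rw [map_prod, map_prod, ← Finset.mul_prod_erase _ _ (Finset.mem_univ σ)]
      exact mul_lt_one_of_lt_of_le (he3 σ hσ) (Finset.prod_le_one' fun τ _ ↦ he2 τ σ)
  have hunit : ∀ σ ∈ D, v (σ f) = 1 := fun σ hσ ↦ by
    refine le_antisymm (hf2 σ) ?_
    have h := hDv σ hσ f⁻¹ (by rw [map_inv₀, hf1, inv_one])
    rw [map_inv₀, map_inv₀] at h
    refine (inv_le_one₀ ?_).1 h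
    rw [v.pos_iff]
    simp only [ne_eq, EmbeddingLike.map_eq_zero_iff]
    rintro rfl
    simp at hf1
  refine ⟨∏ d : D, (d : M ≃ₐ[K] M) f, ?_, ?_, fun σ ↦ ⟨?_, fun hσ ↦ ?_⟩⟩
  · rw [IntermediateField.mem_fixedField_iff]
    intro τ hτ
    rw [map_prod]
    exact Fintype.prod_equiv (Equiv.mulLeft (⟨τ, hτ⟩ : D)) _ _ fun σ ↦ rfl
  · rw [map_prod]; exact Finset.prod_eq_one fun τ _ ↦ hunit τ τ.2
  · rw [map_prod, map_prod]; exact Finset.prod_le_one' fun τ _ ↦ hf2 (σ * τ)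
  · rw [map_prod, map_prod, ← Finset.mul_prod_erase _ _ (Finset.mem_univ 1)]
    exact mul_lt_one_of_lt_of_le (hf3 σ hσ) (Finset.prod_le_one' fun τ _ ↦ hf2 (σ * τ))

/-- In residue characteristic zero, the decomposition field has the same residue field as the
base field. -/
theorem Valuation.exists_sub_lt_one_of_mem_fixedField {K M Γ : Type*} [Field K] [Field M]
    [Algebra K M] [FiniteDimensional K M] [IsGalois K M] [LinearOrderedCommGroupWithZero Γ]
    (v : Valuation M Γ) (hv : ∀ n : ℕ, n ≠ 0 → v n = 1)
    {z : M} (hz : z ∈ IntermediateField.fixedField (v.decompositionGroup K)) (hz1 : v z ≤ 1) :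
    ∃ b : K, v (z - algebraMap K M b) < 1 := by
  classical
  obtain ⟨e, heD, he, he'⟩ := v.exists_isolating_element (K := K) hv
  set D := v.decompositionGroup K with hD
  have hfix : ∀ y : M, y ∈ IntermediateField.fixedField D → (∀ σ : M ≃ₐ[K] M, v (σ y) ≤ 1) →
      ∃ b : K, v (y * e - algebraMap K M b) < 1 := by
    intro y hy hy1
    have hmem : (∑ σ : M ≃ₐ[K] M, σ (y * e)) ∈ Set.range (algebraMap K M) := by
      rw [IsGalois.mem_range_algebraMap_iff_fixed]
      intro τ
      rw [map_sum]
      exact Fintype.sum_equiv (Equiv.mulLeft τ) _ _ fun σ ↦ rfl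
    obtain ⟨b, hb⟩ := hmem
    rw [← Finset.sum_filter_add_sum_filter_not Finset.univ (· ∈ D)] at hb
    have h1 : ∑ σ : M ≃ₐ[K] M with σ ∈ D, σ (y * e) =
        ((Finset.univ.filter (· ∈ D)).card : M) * (y * e) := by
      rw [Finset.sum_congr rfl fun σ hσ ↦ (IntermediateField.mem_fixedField_iff _ _).1
        (mul_mem hy heD) σ (Finset.mem_filter.1 hσ).2, Finset.sum_const, nsmul_eq_mul]
    have h2 : v (∑ σ : M ≃ₐ[K] M with σ ∉ D, σ (y * e)) < 1 := by
      refine v.map_sum_lt one_ne_zero fun σ hσ ↦ ?_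
      rw [map_mul, map_mul, mul_comm]
      exact mul_lt_one_of_lt_of_le ((he' σ).2 (Finset.mem_filter.1 hσ).2) (hy1 σ)
    set n := (Finset.univ.filter (· ∈ D)).card
    have hn : n ≠ 0 := Finset.card_ne_zero.2 ⟨1, by simp [D.one_mem]⟩
    have hn0 : (n : M) ≠ 0 := v.ne_zero_iff.1 (by rw [hv n hn]; exact one_ne_zero)
    refine ⟨b / n, ?_⟩
    rw [map_div₀, hb, h1, map_natCast]
    rw [show y * e - (n * (y * e) + ∑ σ : M ≃ₐ[K] M with σ ∉ D, σ (y * e)) / (n : M) =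
      -((∑ σ : M ≃ₐ[K] M with σ ∉ D, σ (y * e)) / n) by field_simp; ring, v.map_neg, map_div₀,
      hv n hn, div_one]
    exact h2
  let w : (M ≃ₐ[K] M) → Valuation M Γ := fun σ ↦ v.comap (σ : M →+* M)
  have hw : ∀ σ (n : ℕ), n ≠ 0 → w σ n = 1 := fun σ n hn ↦ by simp [w, hv n hn]
  obtain ⟨c, hc⟩ := exists_common_denominator w hw z
  set s := (z ^ 2 + c)⁻¹ with hs
  have hsD : s ∈ IntermediateField.fixedField D :=
    inv_mem (add_mem (pow_mem hz 2) (natCast_mem _ c))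
  obtain ⟨b, hb⟩ := hfix s hsD fun σ ↦ (hc σ).1
  obtain ⟨a, ha⟩ := hfix (z * s) (mul_mem hz hsD) fun σ ↦ (hc σ).2.1
  have hse : v (s * e) = 1 := by rw [map_mul, he, mul_one]; exact (hc 1).2.2.1 hz1
  have hb1 : v (algebraMap K M b) = 1 := by
    rw [v.map_sub_swap, ← hse] at hb
    rw [v.map_eq_of_sub_lt hb, hse]
  have hb0 : algebraMap K M b ≠ 0 := v.ne_zero_iff.1 (by rw [hb1]; exact one_ne_zero)
  refine ⟨a / b, ?_⟩
  have h3 : z - algebraMap K M (a / b) =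
      ((z * s * e - algebraMap K M a) - z * (s * e - algebraMap K M b)) / algebraMap K M b := by
    rw [map_div₀]; field_simp; ring
  rw [h3, map_div₀, hb1, div_one]
  refine v.map_sub_lt ha ?_
  rw [map_mul, mul_comm]
  exact mul_lt_one_of_lt_of_le hb hz1

/-- The extension `M` of the valued field `K` has no proper subextension with the same residue
field as `K`. -/
def Valuation.IsResidueMaximal (K : Type*) {M Γ : Type*} [Field K] [Field M] [Algebra K M]
    [LinearOrderedCommGroupWithZero Γ] (v : Valuation M Γ) : Prop :=
  ∀ F : IntermediateField K M,
    (∀ x ∈ F, v x ≤ 1 → ∃ b : K, v (x - algebraMap K M b) < 1) → F = ⊥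

namespace Valuation.IsResidueMaximal

variable {K M Γ : Type*} [Field K] [Field M] [Algebra K M] [LinearOrderedCommGroupWithZero Γ]
  {v : Valuation M Γ}

/-- A residue-maximal field is Henselian: every automorphism preserves the valuation ring. -/
theorem map_le_one [CharZero K] [IsAlgClosed M] [Algebra.IsAlgebraic K M]
    (h : v.IsResidueMaximal K) (hv : ∀ n : ℕ, n ≠ 0 → v n = 1) (σ : M ≃ₐ[K] M) {x : M}
    (hx : v x ≤ 1) : v (σ x) ≤ 1 := by
  have hint : IsIntegral K x := Algebra.IsIntegral.isIntegral x
  have : FiniteDimensional K (IntermediateField.adjoin K {x}) :=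
    IntermediateField.adjoin.finiteDimensional hint
  let N := IntermediateField.normalClosure K (IntermediateField.adjoin K {x}) M
  have : FiniteDimensional K N := normalClosure.is_finiteDimensional K _ M
  have : Normal K M := normal_iff.2 fun y ↦
    ⟨Algebra.IsIntegral.isIntegral y, IsAlgClosed.splits _⟩
  have : Normal K N := normalClosure.normal K _ M
  have : IsGalois K N := {}
  have hxN : x ∈ N := IntermediateField.le_normalClosure _
    (IntermediateField.mem_adjoin_simple_self K x)
  let w : Valuation N Γ := v.comap (algebraMap N M)
  have hw : ∀ n : ℕ, n ≠ 0 → w n = 1 := fun n hn ↦ by simp [w, hv n hn]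
  have hbot : IntermediateField.fixedField (w.decompositionGroup K) = ⊥ := by
    apply IntermediateField.lift_injective N
    rw [IntermediateField.lift_bot]
    refine h _ fun y hy hy1 ↦ ?_
    lift y to N using IntermediateField.lift_le _ hy
    rw [IntermediateField.mem_lift] at hy
    exact w.exists_sub_lt_one_of_mem_fixedField hw hy hy1
  have htop : w.decompositionGroup K = ⊤ := by
    rw [← IntermediateField.fixingSubgroup_fixedField (w.decompositionGroup K), hbot,
      IntermediateField.fixingSubgroup_bot]
  have hmem : σ.restrictNormal N ∈ w.decompositionGroup K := htop ▸ Subgroup.mem_top _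
  have h1 := mem_decompositionGroup.1 hmem ⟨x, hxN⟩ hx
  have h2 := AlgEquiv.restrictNormal_commutes σ N ⟨x, hxN⟩
  change v (algebraMap N M _) ≤ 1 at h1
  rwa [h2] at h1

end Valuation.IsResidueMaximal

theorem Valuation.le_map_sum_of_pairwise_ne {M Γ ι : Type*} [Field M]
    [LinearOrderedCommGroupWithZero Γ] (v : Valuation M Γ) {s : Finset ι} {f : ι → M}
    (hf : ∀ i ∈ s, ∀ j ∈ s, i ≠ j → f i ≠ 0 → v (f i) ≠ v (f j)) {i : ι} (hi : i ∈ s) :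
    v (f i) ≤ v (∑ j ∈ s, f j) := by
  classical
  obtain ⟨j, hj, hmax⟩ := s.exists_max_image (fun i ↦ v (f i)) ⟨i, hi⟩
  rcases eq_or_ne (f j) 0 with h0 | h0
  · have := hmax i hi
    simp only [h0, map_zero, le_zero_iff] at this
    rw [this]; exact zero_le
  · rw [v.map_sum_eq_of_lt hj]
    · exact hmax i hi
    · intro l hl
      rw [Finset.mem_sdiff, Finset.mem_singleton] at hl
      exact lt_of_le_of_ne (hmax l hl.1) (hf j hj l hl.1 (Ne.symm hl.2) h0).symm

theorem Valuation.pow_sub_eq_of_map_monomial_eq {M Γ : Type*} [Field M]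
    [LinearOrderedCommGroupWithZero Γ] (v : Valuation M Γ) {a b x : M} {i j : ℕ} (hij : i < j)
    (ha : a * x ^ i ≠ 0) (hx : x ≠ 0) (h : v (a * x ^ i) = v (b * x ^ j)) :
    v x ^ (j - i) = v (a / b) := by
  have hb : b * x ^ j ≠ 0 := by
    rw [← v.ne_zero_iff, ← h, v.ne_zero_iff]; exact ha
  rw [map_div₀, eq_div_iff (v.ne_zero_iff.2 (left_ne_zero_of_mul hb))]
  apply mul_right_cancel₀ (pow_ne_zero i (v.ne_zero_iff.2 hx))
  rw [map_mul, map_mul, map_pow, map_pow] at h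
  rw [h, mul_right_comm, ← pow_add, Nat.sub_add_cancel hij.le, mul_comm]

theorem Valuation.exists_pow_eq_of_isAlgebraic {K M Γ : Type*} [Field K] [Field M] [Algebra K M]
    [LinearOrderedCommGroupWithZero Γ] (v : Valuation M Γ) {x : M} (hx : IsAlgebraic K x)
    (hx0 : x ≠ 0) : ∃ n : ℕ, 0 < n ∧ ∃ a : K, v x ^ n = v (algebraMap K M a) := by
  by_contra! hcon
  obtain ⟨p, hp, hpx⟩ := hx
  have hdist : ∀ i j, i < j → algebraMap K M (p.coeff i) * x ^ i ≠ 0 →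
      v (algebraMap K M (p.coeff i) * x ^ i) ≠ v (algebraMap K M (p.coeff j) * x ^ j) := by
    intro i j hij hi heq
    refine hcon (j - i) (by omega) (p.coeff i / p.coeff j) ?_
    rw [v.pow_sub_eq_of_map_monomial_eq hij hi hx0 heq, map_div₀ (algebraMap K M)]
  have h := v.le_map_sum_of_pairwise_ne (s := Finset.range (p.natDegree + 1))
    (f := fun i ↦ algebraMap K M (p.coeff i) * x ^ i) (fun i _ j _ hij hi ↦ by
      rcases lt_or_gt_of_ne hij with hlt | hlt
      · exact hdist i j hlt hi
      · intro heq
        refine hdist j i hlt ?_ heq.symm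
        rw [← v.ne_zero_iff, ← heq, v.ne_zero_iff]
        exact hi) (i := p.natDegree) (by simp)
  have hsum : ∑ i ∈ Finset.range (p.natDegree + 1), algebraMap K M (p.coeff i) * x ^ i = 0 := by
    rw [← hpx, Polynomial.aeval_eq_sum_range]
    simp only [Algebra.smul_def]
  rw [hsum, map_zero, le_zero_iff, v.zero_iff] at h
  simp [hx0, hp] at h

namespace Valuation.IsResidueMaximal

variable {K M Γ : Type*} [Field K] [Field M] [Algebra K M] [LinearOrderedCommGroupWithZero Γ]
  {v : Valuation M Γ}

/-- The valuation of a residue-maximal field takes all values taken on an algebraic closure. -/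
theorem exists_map_eq [IsAlgClosed M] [Algebra.IsAlgebraic K M]
    (h : v.IsResidueMaximal K) {x : M} (hx0 : x ≠ 0) :
    ∃ a : K, v (algebraMap K M a) = v x := by
  classical
  have hex := v.exists_pow_eq_of_isAlgebraic (Algebra.IsAlgebraic.isAlgebraic (R := K) x) hx0
  obtain ⟨hn, a, ha⟩ := Nat.find_spec hex
  have hmin : ∀ m, 0 < m → m < Nat.find hex → ∀ b : K, v x ^ m ≠ v (algebraMap K M b) :=
    fun m hm hlt b hb ↦ Nat.find_min hex hlt ⟨hm, b, hb⟩
  set n := Nat.find hex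
  obtain ⟨y, hy⟩ := IsAlgClosed.exists_pow_nat_eq (algebraMap K M a) hn
  have hyx : v y = v x := by
    rw [← pow_left_inj₀ zero_le zero_le hn.ne', ha, ← map_pow, hy]
  have hy0 : v y ≠ 0 := by rw [hyx, v.ne_zero_iff]; exact hx0
  rw [← hyx] at hmin ⊢
  suffices IntermediateField.adjoin K {y} = ⊥ by
    obtain ⟨b, hb⟩ := IntermediateField.mem_bot.1
      (IntermediateField.adjoin_simple_eq_bot_iff.1 this)
    exact ⟨b, by rw [hb]⟩
  refine h _ fun z hz hz1 ↦ ?_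
  have hyint : IsIntegral K y := Algebra.IsIntegral.isIntegral y
  rw [← IntermediateField.mem_toSubalgebra,
    IntermediateField.adjoin_simple_toSubalgebra_of_isAlgebraic hyint.isAlgebraic,
    Algebra.adjoin_singleton_eq_range_aeval] at hz
  obtain ⟨p, rfl⟩ := hz
  have hq : (Polynomial.X ^ n - Polynomial.C a : Polynomial K).Monic :=
    Polynomial.monic_X_pow_sub_C a hn.ne'
  change v (Polynomial.aeval y p) ≤ 1 at hz1
  change ∃ b : K, v (Polynomial.aeval y p - _) < 1
  rw [← Polynomial.aeval_modByMonic_eq_self_of_root (p := p)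
    (q := Polynomial.X ^ n - Polynomial.C a) (by simp [hy])] at hz1 ⊢
  have hdeg := Polynomial.natDegree_modByMonic_lt p hq (fun h1 ↦ by
    have := congrArg Polynomial.natDegree h1
    rw [Polynomial.natDegree_X_pow_sub_C, Polynomial.natDegree_one] at this
    omega)
  rw [Polynomial.natDegree_X_pow_sub_C] at hdeg
  set r := p %ₘ (Polynomial.X ^ n - Polynomial.C a)
  have hdist : ∀ i j, i < j → j < n → algebraMap K M (r.coeff i) * y ^ i ≠ 0 →
      v (algebraMap K M (r.coeff i) * y ^ i) ≠ v (algebraMap K M (r.coeff j) * y ^ j) := by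
    intro i j hij hjn hi heq
    refine hmin (j - i) (by omega) (by omega) (r.coeff i / r.coeff j) ?_
    rw [v.pow_sub_eq_of_map_monomial_eq hij hi (v.ne_zero_iff.1 hy0) heq, map_div₀ (algebraMap K M)]
  have hsum : Polynomial.aeval y r =
      ∑ i ∈ Finset.range n, algebraMap K M (r.coeff i) * y ^ i := by
    rw [Polynomial.aeval_eq_sum_range' hdeg]
    simp only [Algebra.smul_def]
  rw [hsum] at hz1 ⊢
  have hterm : ∀ i ∈ Finset.range n, v (algebraMap K M (r.coeff i) * y ^ i) ≤ 1 := fun i hi ↦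
    (v.le_map_sum_of_pairwise_ne (f := fun i ↦ algebraMap K M (r.coeff i) * y ^ i)
      (fun i hi j hj hij h0 ↦ by
        rw [Finset.mem_range] at hi hj
        rcases lt_or_gt_of_ne hij with hlt | hlt
        · exact hdist i j hlt hj h0
        · intro heq
          refine hdist j i hlt hi ?_ heq.symm
          rw [← v.ne_zero_iff, ← heq, v.ne_zero_iff]
          exact h0) hi).trans hz1
  refine ⟨r.coeff 0, ?_⟩
  rw [← Finset.add_sum_erase _ _ (Finset.mem_range.2 hn), pow_zero, mul_one, add_sub_cancel_left]
  refine v.map_sum_lt one_ne_zero fun i hi ↦ ?_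
  obtain ⟨hi0, hin⟩ := Finset.mem_erase.1 hi
  refine lt_of_le_of_ne (hterm i hin) fun heq ↦ ?_
  rw [map_mul, map_pow] at heq
  refine hmin i (Nat.pos_of_ne_zero hi0) (Finset.mem_range.1 hin) (r.coeff i)⁻¹ ?_
  rw [map_inv₀, map_inv₀]
  exact eq_inv_of_mul_eq_one_right heq

/-- Over a residue-maximal field, an automorphism acting trivially on representatives of the
residue field is trivial. -/
theorem eq_one_of_fixes_residues [CharZero K] [IsAlgClosed M] [Algebra.IsAlgebraic K M]
    (h : v.IsResidueMaximal K) (hv : ∀ n : ℕ, n ≠ 0 → v n = 1) (σ : M ≃ₐ[K] M)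
    (hσ : ∀ x, v x ≤ 1 → ∃ b, σ b = b ∧ v (x - b) < 1) : σ = 1 := by
  have hlt : ∀ x, v x < 1 → v (σ x) < 1 := by
    intro x hx
    by_contra! h1
    have h2 := h.map_le_one hv σ⁻¹ (x := (σ x)⁻¹)
      (by rw [map_inv₀]; exact inv_le_one_of_one_le₀ h1)
    rw [map_inv₀, map_inv₀] at h2
    have hs : σ⁻¹ (σ x) = x := σ.symm_apply_apply x
    rw [hs] at h2
    have hx0 : x ≠ 0 := by
      rintro rfl
      simp at h1
    exact absurd ((inv_le_one₀ (v.pos_iff.2 hx0)).1 h2) (not_le.2 hx)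
  have key : ∀ (m : ℕ) (x : M), m ≠ 0 → ∑ i ∈ Finset.range m, (σ ^ i) x = 0 → x = 0 := by
    intro m x hm hsum
    by_contra hx0
    obtain ⟨c, hc⟩ := h.exists_map_eq hx0
    have hc0 : algebraMap K M c ≠ 0 := by
      rw [← v.ne_zero_iff, hc, v.ne_zero_iff]; exact hx0
    have hxc : v (x / algebraMap K M c) = 1 := by
      rw [map_div₀, hc, div_self (v.ne_zero_iff.2 hx0)]
    obtain ⟨b, hb, hxb⟩ := hσ _ hxc.le
    have hi : ∀ i, v ((σ ^ i) x / algebraMap K M c - b) < 1 := fun i ↦ by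
      induction i with
      | zero => simpa using hxb
      | succ i ih =>
        have := hlt _ ih
        rwa [_root_.map_sub, map_div₀, AlgEquiv.commutes, hb, ← AlgEquiv.mul_apply,
          ← pow_succ'] at this
    have h3 := v.map_sum_lt (s := Finset.range m) one_ne_zero fun i _ ↦ hi i
    rw [Finset.sum_sub_distrib, ← Finset.sum_div, hsum, zero_div, zero_sub, v.map_neg,
      Finset.sum_const, Finset.card_range, nsmul_eq_mul, map_mul, hv m hm, one_mul] at h3
    have h4 := v.map_add_lt hxb h3
    rw [sub_add_cancel, hxc] at h4
    exact lt_irrefl _ h4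
  ext x
  change σ x = x
  obtain ⟨m, hm, hmx⟩ : ∃ m : ℕ, m ≠ 0 ∧ (σ ^ m) x = x := by
    have hfin : Finite ((minpoly K x).rootSet M) := (minpoly K x).rootSet_finite M
    have hroot : ∀ i : ℕ, (σ ^ i) x ∈ (minpoly K x).rootSet M := fun i ↦ by
      rw [Polynomial.mem_rootSet]
      refine ⟨minpoly.ne_zero (Algebra.IsIntegral.isIntegral x), ?_⟩
      change Polynomial.aeval (((σ ^ i : M ≃ₐ[K] M) : M →ₐ[K] M) x) _ = 0
      rw [Polynomial.aeval_algHom_apply, minpoly.aeval, _root_.map_zero]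
    obtain ⟨i, j, hij, heq⟩ := Finite.exists_ne_map_eq_of_infinite
      fun i : ℕ ↦ (⟨(σ ^ i) x, hroot i⟩ : (minpoly K x).rootSet M)
    rw [Subtype.mk.injEq] at heq
    wlog hlt : i < j generalizing i j
    · exact this j i hij.symm heq.symm (by omega)
    refine ⟨j - i, by omega, ?_⟩
    apply (σ ^ i).injective
    rw [← AlgEquiv.mul_apply, ← pow_add, Nat.add_sub_cancel' hlt.le, heq]
  have hm0 : (m : M) ≠ 0 := v.ne_zero_iff.1 (by rw [hv m hm]; exact one_ne_zero)
  set y := (∑ i ∈ Finset.range m, (σ ^ i) x) / m with hy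
  have hσy : σ y = y := by
    rw [hy, map_div₀, map_natCast, map_sum]
    congr 1
    have h5 := Finset.sum_range_succ (fun i ↦ (σ ^ i) x) m
    rw [Finset.sum_range_succ', hmx, pow_zero, AlgEquiv.one_apply, add_left_inj] at h5
    rw [← h5]
    exact Finset.sum_congr rfl fun i _ ↦ by rw [pow_succ', AlgEquiv.mul_apply]
  have hpow : ∀ i : ℕ, (σ ^ i) y = y := fun i ↦ by
    induction i with
    | zero => rfl
    | succ i ih => rw [pow_succ', AlgEquiv.mul_apply, ih, hσy]
  have hxy := key m (x - y) hm (by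
    simp only [_root_.map_sub, hpow, Finset.sum_sub_distrib, Finset.sum_const, Finset.card_range,
      nsmul_eq_mul]
    rw [hy]; field_simp; ring)
  rw [sub_eq_zero.1 hxy, hσy]

end Valuation.IsResidueMaximal

section Residues

variable {k K M Γ : Type*} [Field k] [Field K] [Field M] [Algebra k M] [Algebra K M]
  [LinearOrderedCommGroupWithZero Γ] {v : Valuation M Γ}

theorem Valuation.map_algebraMap_eq_one (hk : ∀ a : k, v (algebraMap k M a) ≤ 1) {a : k}
    (ha : a ≠ 0) : v (algebraMap k M a) = 1 := by
  refine le_antisymm (hk a) ?_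
  have h := hk a⁻¹
  rw [map_inv₀, map_inv₀] at h
  exact (inv_le_one₀ (v.pos_iff.2 (by simpa using ha))).1 h

theorem Valuation.map_eq_one_of_isAlgebraic (hk : ∀ a : k, v (algebraMap k M a) ≤ 1) {x : M}
    (hx : IsAlgebraic k x) (hx0 : x ≠ 0) : v x = 1 := by
  obtain ⟨n, hn, a, ha⟩ := v.exists_pow_eq_of_isAlgebraic hx hx0
  have ha0 : a ≠ 0 := by
    rintro rfl
    rw [map_zero, map_zero] at ha
    exact pow_ne_zero n (v.ne_zero_iff.2 hx0) ha
  rw [v.map_algebraMap_eq_one hk ha0] at ha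
  exact (pow_eq_one_iff_of_nonneg zero_le hn.ne').1 ha

/-- If the residue field of `K` is `k`, every residue class of an algebraically closed algebraic
extension has a representative which is algebraic over `k`. -/
theorem Valuation.exists_isAlgebraic_sub_lt_one [IsAlgClosed M] [Algebra.IsAlgebraic K M]
    (hk : ∀ a : k, v (algebraMap k M a) ≤ 1)
    (hres : ∀ x : K, v (algebraMap K M x) ≤ 1 →
      ∃ a : k, v (algebraMap K M x - algebraMap k M a) < 1)
    {x : M} (hx : v x ≤ 1) : ∃ b : M, IsAlgebraic k b ∧ v (x - b) < 1 := by
  classical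
  obtain ⟨p, hp, hpx⟩ := Algebra.IsAlgebraic.isAlgebraic (R := K) x
  obtain ⟨j, hj, hmax⟩ := p.support.exists_max_image (fun i ↦ v (algebraMap K M (p.coeff i)))
    (Polynomial.support_nonempty.2 hp)
  have hj0 : p.coeff j ≠ 0 := Polynomial.mem_support_iff.1 hj
  have hvj : v (algebraMap K M (p.coeff j)) ≠ 0 := v.ne_zero_iff.2 (by simpa using hj0)
  let c : ℕ → K := fun i ↦ p.coeff i / p.coeff j
  have hc : ∀ i, v (algebraMap K M (c i)) ≤ 1 := fun i ↦ by
    rw [map_div₀, map_div₀]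
    by_cases hi : i ∈ p.support
    · exact div_le_one_of_le₀ (hmax i hi) zero_le
    · simp [Polynomial.notMem_support_iff.1 hi]
  choose a ha using fun i ↦ hres (c i) (hc i)
  let g : Polynomial k := ∑ i ∈ Finset.range (p.natDegree + 1), Polynomial.monomial i (a i)
  have hjr : j < p.natDegree + 1 := Nat.lt_succ_of_le (Polynomial.le_natDegree_of_mem_supp j hj)
  have hgj : g.coeff j = a j := by
    simp [g, Polynomial.coeff_monomial, hjr]
  have haj : a j ≠ 0 := by
    intro h0
    have := ha j
    simp [h0, c, div_self hj0] at this
  have hg : g ≠ 0 := by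
    intro h0
    rw [h0, Polynomial.coeff_zero] at hgj
    exact haj hgj.symm
  have hgx : v (Polynomial.aeval x g) < 1 := by
    have h0 : ∑ i ∈ Finset.range (p.natDegree + 1), algebraMap K M (c i) * x ^ i = 0 := by
      have h1 : ∑ i ∈ Finset.range (p.natDegree + 1), algebraMap K M (p.coeff i) * x ^ i = 0 := by
        rw [← hpx, Polynomial.aeval_eq_sum_range]
        simp only [Algebra.smul_def]
      rw [← zero_div (algebraMap K M (p.coeff j)), ← h1, Finset.sum_div]
      refine Finset.sum_congr rfl fun i _ ↦ ?_
      rw [map_div₀, div_mul_eq_mul_div]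
    have h2 : Polynomial.aeval x g = -∑ i ∈ Finset.range (p.natDegree + 1),
        (algebraMap K M (c i) - algebraMap k M (a i)) * x ^ i := by
      simp only [sub_mul, Finset.sum_sub_distrib, h0, zero_sub, neg_neg, g, map_sum,
        Polynomial.aeval_monomial]
    rw [h2, v.map_neg]
    refine v.map_sum_lt one_ne_zero fun i _ ↦ ?_
    rw [map_mul, map_pow]
    exact mul_lt_one_of_lt_of_le (ha i) (pow_le_one₀ zero_le hx)
  by_contra! hcon
  have hsplit := (IsAlgClosed.splits (g.map (algebraMap k M))).eq_prod_roots
  rw [Polynomial.aeval_def, ← Polynomial.eval_map, hsplit, Polynomial.eval_mul,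
    Polynomial.eval_C, Polynomial.eval_multiset_prod, Multiset.map_map, map_mul,
    Polynomial.leadingCoeff_map,
    v.map_algebraMap_eq_one hk (Polynomial.leadingCoeff_ne_zero.2 hg), one_mul,
    map_multiset_prod, Multiset.map_map] at hgx
  refine absurd hgx (not_lt.2 (Multiset.one_le_prod_of_one_le ?_))
  intro y hy
  obtain ⟨b, hb, rfl⟩ := Multiset.mem_map.1 hy
  have := hcon b ⟨g, hg, by
    rw [Polynomial.aeval_def, ← Polynomial.eval_map]
    exact (Polynomial.mem_roots'.1 hb).2⟩
  simpa using this

/-- There is a residue-maximal intermediate field among those with residue field `k`. -/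
theorem Valuation.exists_isResidueMaximal
    (hres : ∀ x : K, v (algebraMap K M x) ≤ 1 →
      ∃ a : k, v (algebraMap K M x - algebraMap k M a) < 1) :
    ∃ L : IntermediateField K M, v.IsResidueMaximal L ∧
      ∀ x ∈ L, v x ≤ 1 → ∃ a : k, v (x - algebraMap k M a) < 1 := by
  obtain ⟨L, -, hL⟩ := zorn_le_nonempty₀
    {F : IntermediateField K M | ∀ x ∈ F, v x ≤ 1 → ∃ a : k, v (x - algebraMap k M a) < 1}
    (fun c hcs hc y hy ↦ by
      have : Nonempty c := ⟨⟨y, hy⟩⟩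
      refine ⟨⨆ F : c, (F : IntermediateField K M), fun x hx hx1 ↦ ?_,
        fun F hF ↦ le_iSup (fun F : c ↦ (F : IntermediateField K M)) ⟨F, hF⟩⟩
      rw [← SetLike.mem_coe, IntermediateField.coe_iSup_of_directed hc.directed,
        Set.mem_iUnion] at hx
      obtain ⟨F, hF⟩ := hx
      exact hcs F.2 x hF hx1) ⊥ (by
      intro x hx hx1
      obtain ⟨b, rfl⟩ := IntermediateField.mem_bot.1 hx
      exact hres b hx1)
  refine ⟨L, fun F hF ↦ ?_, hL.prop⟩
  have hle : L ≤ F.restrictScalars K := fun x hx ↦ F.algebraMap_mem ⟨x, hx⟩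
  have hmem : F.restrictScalars K ∈ {F : IntermediateField K M |
      ∀ x ∈ F, v x ≤ 1 → ∃ a : k, v (x - algebraMap k M a) < 1} := by
    intro x hx hx1
    obtain ⟨b, hb⟩ := hF x hx hx1
    have hb1 : v (algebraMap L M b) ≤ 1 := by
      have := v.map_sub_le hx1 hb.le
      rwa [sub_sub_cancel] at this
    obtain ⟨a, ha⟩ := hL.prop b b.2 hb1
    refine ⟨a, ?_⟩
    have := v.map_add_lt hb ha
    rwa [IntermediateField.algebraMap_apply, sub_add_sub_cancel] at this
  refine le_bot_iff.1 fun x hx ↦ ?_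
  exact IntermediateField.mem_bot.2 ⟨⟨x, hL.le_of_ge hmem hle hx⟩, rfl⟩

end Residues

section Restriction

variable {k K M : Type*} [Field k] [Field K] [Field M] [Algebra k K] [Algebra K M] [Algebra k M]
  [IsScalarTower k K M] [IsAlgClosed M]

theorem coe_resHom_apply (σ : M ≃ₐ[K] M) (x : algebraicClosure k M) :
    (resHom k K M σ x : M) = σ x :=
  AlgEquiv.restrictNormal_commutes (σ.restrictScalars k) (algebraicClosure k M) x

theorem continuous_resHom : Continuous (resHom k K M) := by
  refine (InfiniteGalois.restrictNormalHom_continuous (algebraicClosure k M)).comp ?_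
  refine continuous_of_continuousAt_one _ (continuousAt_def.2 fun N hN ↦ ?_)
  rw [map_one, krullTopology_mem_nhds_one_iff] at hN
  obtain ⟨E, hE, hEN⟩ := hN
  rw [krullTopology_mem_nhds_one_iff]
  obtain ⟨S, hS⟩ := (IntermediateField.essFiniteType_iff (K := E)).1 inferInstance
  have hint : ∀ x ∈ S, IsIntegral K x := fun x hx ↦ by
    have hxE : x ∈ E := hS ▸ IntermediateField.subset_adjoin k _ hx
    have : IsIntegral k (⟨x, hxE⟩ : E) := Algebra.IsIntegral.isIntegral _
    exact (this.map E.val).tower_top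
  refine ⟨IntermediateField.adjoin K S, IntermediateField.finiteDimensional_adjoin hint,
    fun σ hσ ↦ hEN ?_⟩
  rw [SetLike.mem_coe, IntermediateField.mem_fixingSubgroup_iff] at hσ ⊢
  intro x hx
  refine hσ x ?_
  have hle : E ≤ (IntermediateField.adjoin K (S : Set M)).restrictScalars k := by
    rw [← hS, IntermediateField.adjoin_le_iff]
    exact IntermediateField.subset_adjoin K _
  exact hle hx

/-- A continuous splitting of the restriction homomorphism from a field `L` over which restriction
is injective and in which `k` is algebraically closed. -/
theorem exists_continuous_section_resHom [CharZero k] [Algebra.IsAlgebraic K M]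
    (L : IntermediateField K M)
    (hinj : ∀ σ ∈ L.fixingSubgroup, resHom k K M σ = 1 → σ = 1)
    (hL : ∀ x ∈ L, IsAlgebraic k x → x ∈ Set.range (algebraMap k M)) :
    ∃ s : (algebraicClosure k M ≃ₐ[k] algebraicClosure k M) →* (M ≃ₐ[K] M),
      Continuous s ∧ (∀ g, resHom k K M (s g) = g) ∧ ∀ g, s g ∈ L.fixingSubgroup := by
  have : CharZero K := charZero_of_injective_algebraMap (algebraMap k K).injective
  have : Normal K M := normal_iff.2 fun y ↦
    ⟨Algebra.IsIntegral.isIntegral y, IsAlgClosed.splits _⟩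
  have : IsGalois K M := {}
  have : IsGalois k (algebraicClosure k M) := {}
  let ψ : L.fixingSubgroup →* (algebraicClosure k M ≃ₐ[k] algebraicClosure k M) :=
    (resHom k K M).comp L.fixingSubgroup.subtype
  have hψ : Continuous ψ := continuous_resHom.comp continuous_subtype_val
  have : CompactSpace L.fixingSubgroup :=
    isCompact_iff_compactSpace.1 (InfiniteGalois.fixingSubgroup_isClosed L).isCompact
  have hψi : Function.Injective ψ := by
    rw [injective_iff_map_eq_one]
    exact fun σ hσ ↦ Subtype.ext (hinj σ σ.2 hσ)
  have hψs : Function.Surjective ψ := by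
    rw [← MonoidHom.range_eq_top]
    let H : ClosedSubgroup (algebraicClosure k M ≃ₐ[k] algebraicClosure k M) :=
      ⟨ψ.range, by
        change IsClosed (Set.range ψ)
        exact (isCompact_range hψ).isClosed⟩
    have hbot : IntermediateField.fixedField H.1 = ⊥ := by
      refine le_bot_iff.1 fun x hx ↦ ?_
      rw [IntermediateField.mem_fixedField_iff] at hx
      have hxL : (x : M) ∈ L := by
        rw [← InfiniteGalois.fixedField_fixingSubgroup L, IntermediateField.mem_fixedField_iff]
        intro σ hσ
        exact (coe_resHom_apply σ x).symm.trans (congrArg _ (hx _ ⟨⟨σ, hσ⟩, rfl⟩))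
      obtain ⟨a, ha⟩ := hL x hxL (mem_algebraicClosure_iff.1 x.2)
      exact IntermediateField.mem_bot.2 ⟨a, Subtype.ext ha⟩
    change H.1 = ⊤
    rw [← InfiniteGalois.fixingSubgroup_fixedField H, hbot, IntermediateField.fixingSubgroup_bot]
  let e := MulEquiv.ofBijective ψ ⟨hψi, hψs⟩
  have he : Continuous e.symm :=
    Continuous.continuous_symm_of_equiv_compact_to_t2 (f := e.toEquiv) hψ
  exact ⟨L.fixingSubgroup.subtype.comp e.symm.toMonoidHom, continuous_subtype_val.comp he,
    fun g ↦ e.apply_symm_apply g, fun g ↦ (e.symm g).2⟩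

end Restriction

theorem ValuationSubring.exists_sub_lt_one_of_residueEmbed_surjective {k K M : Type*} [Field k]
    [Field K] [Field M] [Algebra k K] [Algebra K M] [Algebra k M] [IsScalarTower k K M]
    (O : ValuationSubring M) (hk : ∀ a : k, algebraMap k K a ∈ O.comap (algebraMap K M))
    (hres : Function.Surjective (residueEmbed (O.comap (algebraMap K M)) hk)) (x : K)
    (hx : O.valuation (algebraMap K M x) ≤ 1) :
    ∃ a : k, O.valuation (algebraMap K M x - algebraMap k M a) < 1 := by
  have hxO : x ∈ O.comap (algebraMap K M) := (O.valuation_le_one_iff _).1 hx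
  obtain ⟨a, ha⟩ := hres (IsLocalRing.residue _ ⟨x, hxO⟩)
  refine ⟨a, ?_⟩
  rw [residueEmbed, eq_comm, ← sub_eq_zero, ← map_sub, IsLocalRing.residue_eq_zero_iff,
    IsLocalRing.mem_maximalIdeal, _root_.mem_nonunits_iff] at ha
  by_contra! hge
  rw [IsScalarTower.algebraMap_apply k K M, ← map_sub] at hge
  have hinv : (x - algebraMap k K a)⁻¹ ∈ O.comap (algebraMap K M) := by
    rw [mem_comap, ← valuation_le_one_iff, map_inv₀, map_inv₀]
    exact inv_le_one_of_one_le₀ hge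
  have hne : x - algebraMap k K a ≠ 0 := by
    intro h0
    rw [h0, map_zero, map_zero] at hge
    exact absurd hge (not_le.2 zero_lt_one)
  exact ha (IsUnit.of_mul_eq_one ⟨_, hinv⟩ (Subtype.ext (mul_inv_cancel₀ hne)))

/-- Let `k/ℚ_p` be finite, `K/k` a field extension, and `Ō` a valuation
subring of `Kbar` containing `k` such that `O = Ō ∩ K` has residue field `k`.  Then there
is a birational Galois section `s : Gal_k → Gal_K` with image inside the decomposition
subgroup `D_Ō`; in particular the packet of sections associated to `Ō` is nonempty. -/
theorem exists_section_in_decomposition_group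
    (p : ℕ) [Fact p.Prime]
    (k : Type) [Field k] [Algebra ℚ_[p] k] [FiniteDimensional ℚ_[p] k]
    (K Kbar : Type) [Field K] [Field Kbar]
    [Algebra k K] [Algebra K Kbar] [Algebra k Kbar] [IsScalarTower k K Kbar]
    [IsAlgClosed Kbar] [Algebra.IsAlgebraic K Kbar]
    (Obar : ValuationSubring Kbar)
    (hk : ∀ a : k, algebraMap k Kbar a ∈ Obar)
    (hres : Function.Bijective (residueEmbed (Obar.comap (algebraMap K Kbar))
      (fun a => by
        rw [ValuationSubring.mem_comap, ← IsScalarTower.algebraMap_apply k K Kbar]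
        exact hk a))) :
    ∃ s : ((algebraicClosure k Kbar) ≃ₐ[k] (algebraicClosure k Kbar)) →* (Kbar ≃ₐ[K] Kbar),
      Continuous s ∧
      (∀ g, resHom k K Kbar (s g) = g) ∧
      (∀ g, ∀ x : Kbar, x ∈ Obar ↔ s g x ∈ Obar) := by
  have : CharZero k := charZero_of_injective_algebraMap (algebraMap ℚ_[p] k).injective
  have hkv : ∀ a : k, Obar.valuation (algebraMap k Kbar a) ≤ 1 := fun a ↦
    (Obar.valuation_le_one_iff _).2 (hk a)
  have hv : ∀ n : ℕ, n ≠ 0 → Obar.valuation (n : Kbar) = 1 := fun n hn ↦ by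
    rw [← map_natCast (algebraMap k Kbar)]
    exact Obar.valuation.map_algebraMap_eq_one hkv (Nat.cast_ne_zero.2 hn)
  obtain ⟨L, hLmax, hLres⟩ := Valuation.exists_isResidueMaximal
    (Obar.exists_sub_lt_one_of_residueEmbed_surjective _ hres.surjective)
  have : CharZero K := charZero_of_injective_algebraMap (algebraMap k K).injective
  have : CharZero L := charZero_of_injective_algebraMap (algebraMap K L).injective
  have : Algebra.IsAlgebraic L Kbar := Algebra.IsAlgebraic.tower_top (K := K) L
  obtain ⟨s, hs, hsec, hsL⟩ := exists_continuous_section_resHom (k := k) L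
    (fun σ hσ h1 ↦ by
      have h2 := hLmax.eq_one_of_fixes_residues hv
        (IntermediateField.fixingSubgroupEquiv L ⟨σ, hσ⟩)
        fun x hx ↦ by
          obtain ⟨b, hb, hxb⟩ := Valuation.exists_isAlgebraic_sub_lt_one (K := L) hkv
            (fun x hx ↦ hLres x x.2 hx) hx
          refine ⟨b, ?_, hxb⟩
          have h3 := coe_resHom_apply (k := k) σ ⟨b, mem_algebraicClosure_iff.2 hb⟩
          rw [h1] at h3
          exact h3.symm
      ext x
      exact DFunLike.congr_fun h2 x)
    (fun x hx halg ↦ by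
      rcases eq_or_ne x 0 with rfl | hx0
      · exact ⟨0, map_zero _⟩
      obtain ⟨a, ha⟩ := hLres x hx (Valuation.map_eq_one_of_isAlgebraic hkv halg hx0).le
      refine ⟨a, ?_⟩
      by_contra hne
      rw [Valuation.map_eq_one_of_isAlgebraic hkv (halg.sub (isAlgebraic_algebraMap a))
        (sub_ne_zero.2 (Ne.symm hne))] at ha
      exact lt_irrefl _ ha)
  refine ⟨s, hs, hsec, fun g x ↦ ?_⟩
  have hmap : ∀ g x, x ∈ Obar → s g x ∈ Obar := fun g x hx ↦ by
    rw [← Obar.valuation_le_one_iff] at hx ⊢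
    exact hLmax.map_le_one hv (IntermediateField.fixingSubgroupEquiv L ⟨s g, hsL g⟩) hx
  refine ⟨hmap g x, fun hx ↦ ?_⟩
  have h := hmap g⁻¹ _ hx
  rwa [← AlgEquiv.mul_apply, ← map_mul, inv_mul_cancel, map_one, AlgEquiv.one_apply] at h
end

section
/- Let k ⊆ K be fields of characteristic zero, let s : Gal_k → Gal_K be a birational Galois section, and let L = K̄^{s(Gal_k)} be the fixed field in K̄ of the image of s. Then k is relatively algebraically closed in L (every element of L algebraic over k lies in k), and the relative algebraic closure of ℚ in L equals the relative algebraic closure of ℚ in k (the fields of absolutely algebraic elements of L and of k agree). -/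
section

variable {k K Kbar : Type*} [Field k] [Field K] [Field Kbar]
  [Algebra k K] [Algebra K Kbar] [Algebra k Kbar] [IsScalarTower k K Kbar] [IsAlgClosed Kbar]

theorem resHom_apply_coe (σ : Kbar ≃ₐ[K] Kbar) (y : algebraicClosure k Kbar) :
    (resHom k K Kbar σ y : Kbar) = σ y :=
  AlgEquiv.restrictNormal_commutes (σ.restrictScalars k) (algebraicClosure k Kbar) y

/-- An element algebraic over `k` and fixed by the image of a section of `resHom` is fixed by the
whole Galois group of `k`, hence lies in `k`. -/
theorem mem_range_of_mem_fixedField_range_section [CharZero k]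
    (s : (algebraicClosure k Kbar ≃ₐ[k] algebraicClosure k Kbar) →* (Kbar ≃ₐ[K] Kbar))
    (hs : ∀ g, resHom k K Kbar (s g) = g) {x : Kbar}
    (hx : x ∈ IntermediateField.fixedField s.range) (hxk : IsAlgebraic k x) :
    x ∈ (algebraMap k Kbar).range := by
  have : IsGalois k (algebraicClosure k Kbar) := {}
  let y : algebraicClosure k Kbar := ⟨x, mem_algebraicClosure_iff.2 hxk⟩
  obtain ⟨a, ha⟩ := (InfiniteGalois.mem_range_algebraMap_iff_fixed y).2 fun g => Subtype.ext <| by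
    rw [← hs g, resHom_apply_coe]
    exact (IntermediateField.mem_fixedField_iff _ _).1 hx (s g) ⟨g, rfl⟩
  exact ⟨a, congrArg Subtype.val ha⟩

end

/-- Let `k ⊆ K` be fields of characteristic zero, `s : Gal_k → Gal_K` a
birational Galois section and `L = K̄^{s(Gal_k)}` the fixed field of its image.  Then
every element of `L` algebraic over `k` lies in `k`, and the absolutely algebraic
elements of `L` are exactly the absolutely algebraic elements of `k` (as subsets of
`K̄`). -/
theorem fixedField_relatively_algebraically_closed_and_absolute_elements
    (k K Kbar : Type) [Field k] [Field K] [Field Kbar] [CharZero k] [CharZero K]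
    [CharZero Kbar]
    [Algebra k K] [Algebra K Kbar] [Algebra k Kbar] [IsScalarTower k K Kbar]
    [IsAlgClosed Kbar] [Algebra.IsAlgebraic K Kbar]
    (s : ((algebraicClosure k Kbar) ≃ₐ[k] (algebraicClosure k Kbar)) →* (Kbar ≃ₐ[K] Kbar))
    (hs_cont : Continuous s)
    (hs_sec : ∀ g, resHom k K Kbar (s g) = g) :
    (∀ x : Kbar, x ∈ IntermediateField.fixedField s.range → IsAlgebraic k x →
      x ∈ (algebraMap k Kbar).range) ∧
    {x : Kbar | x ∈ IntermediateField.fixedField s.range ∧ IsAlgebraic ℚ x} =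
      {x : Kbar | x ∈ (algebraMap k Kbar).range ∧ IsAlgebraic ℚ x} := by
  refine ⟨fun x hx hxk => mem_range_of_mem_fixedField_range_section s hs_sec hx hxk, ?_⟩
  ext x
  refine ⟨fun ⟨hx, hxQ⟩ =>
    ⟨mem_range_of_mem_fixedField_range_section s hs_sec hx (hxQ.tower_top (L := k)), hxQ⟩, ?_⟩
  rintro ⟨⟨a, rfl⟩, hxQ⟩
  refine ⟨?_, hxQ⟩
  rw [IsScalarTower.algebraMap_apply k K Kbar]
  exact IntermediateField.algebraMap_mem _ _
end

section
/- Let F be a field and let A ⊆ B be valuation subrings of F (so B is a coarsening of A). If A is a henselian local ring, then B is a henselian local ring. -/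
/-!
A coarsening of a henselian valuation ring is henselian.
-/

open Polynomial IsLocalRing in
/-- Over a henselian local ring, an equation `1 - z + ∑ dᵢ z ^ (i + 2) = 0` with
all `dᵢ` in the maximal ideal is solvable: its reversal is monic with simple residual root `1`. -/
theorem HenselianLocalRing.exists_one_sub_add_sum_eq_zero {R : Type*} [CommRing R]
    [HenselianLocalRing R] (m : ℕ) (d : ℕ → R) (hd : ∀ i, d i ∈ maximalIdeal R) :
    ∃ z : R, 1 - z + ∑ i ∈ Finset.range m, d i * z ^ (i + 2) = 0 := by
  let q : R[X] := ∑ i ∈ Finset.range m, C (d i) * X ^ (m - 1 - i)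
  have hq : (-X ^ m + q).degree < ((m + 1 : ℕ) : WithBot ℕ) := by
    refine (degree_add_le _ _).trans_lt (max_lt ?_ ?_)
    · rw [degree_neg]
      exact (degree_X_pow_le m).trans_lt (by exact_mod_cast Nat.lt_succ_self m)
    · refine (degree_sum_le _ _).trans_lt ((Finset.sup_lt_iff (WithBot.bot_lt_coe _)).2 ?_)
      intro i _
      refine (degree_C_mul_X_pow_le _ _).trans_lt ?_
      have : m - 1 - i < m + 1 := by omega
      exact_mod_cast this
  obtain ⟨w, hw, hw1⟩ := HenselianLocalRing.is_henselian (X ^ (m + 1) + (-X ^ m + q))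
    (monic_X_pow_add hq) 1
    (by
      simp only [q, eval_add, eval_neg, eval_pow, eval_X, one_pow, eval_finsetSum, eval_mul,
        eval_C, mul_one, add_neg_cancel_left]
      exact Ideal.sum_mem _ fun i _ => hd i)
    (by
      have hmem : q.derivative.eval 1 ∈ maximalIdeal R := by
        simp only [q, derivative_sum, derivative_C_mul_X_pow, eval_finsetSum, eval_mul, eval_C,
          eval_pow, eval_X, one_pow, mul_one]
        exact Ideal.sum_mem _ fun i _ => Ideal.mul_mem_right _ _ (hd i)
      have heq : (X ^ (m + 1) + (-X ^ m + q)).derivative.eval 1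
          = 1 + q.derivative.eval 1 := by
        simp [derivative_X_pow]
        ring
      rw [heq]
      by_contra h
      exact (maximalIdeal R).ne_top_iff_one.1 (maximalIdeal.isMaximal R).ne_top
        ((Ideal.add_mem_iff_left _ hmem).1 ((mem_maximalIdeal _).2 h)))
  have hwu : IsUnit w := by
    by_contra h
    refine (maximalIdeal R).ne_top_iff_one.1 (maximalIdeal.isMaximal R).ne_top ?_
    have := Ideal.sub_mem _ ((mem_maximalIdeal w).2 h) hw1
    simp at this
  obtain ⟨z, hz⟩ := hwu.exists_right_inv
  refine ⟨z, ?_⟩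
  have hpow : ∀ k, z ^ k * w ^ k = 1 := fun k => by
    rw [← mul_pow, mul_comm, hz, one_pow]
  have hsum : ∑ i ∈ Finset.range m, d i * z ^ (i + 2) = z ^ (m + 1) * q.eval w := by
    simp only [q, eval_finsetSum, eval_mul, eval_C, eval_pow, eval_X, Finset.mul_sum]
    refine Finset.sum_congr rfl fun i hi => ?_
    have hi' := Finset.mem_range.1 hi
    have : m + 1 = (i + 2) + (m - 1 - i) := by omega
    rw [this, pow_add]
    linear_combination (-(d i * z ^ (i + 2))) * hpow (m - 1 - i)
  have hroot : w ^ (m + 1) + (-w ^ m + q.eval w) = 0 := by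
    simpa [IsRoot] using hw
  rw [hsum]
  linear_combination z ^ (m + 1) * hroot - hpow (m + 1) + z * hpow m

/-- The maximal ideal of a coarsening is contained in the maximal ideal of the valuation ring. -/
theorem ValuationSubring.exists_mem_maximalIdeal_of_le {F : Type*} [Field F]
    {A B : ValuationSubring F} (hAB : A ≤ B) {x : B} (hx : x ∈ IsLocalRing.maximalIdeal B) :
    ∃ a ∈ IsLocalRing.maximalIdeal A, A.inclusion B hAB a = x := by
  have hxA : (x : F) ∈ A := by
    rcases A.mem_or_inv_mem (x : F) with h | h
    · exact h
    · by_cases h0 : (x : F) = 0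
      · rw [h0]; exact A.zero_mem
      · refine absurd ?_ ((IsLocalRing.mem_maximalIdeal x).1 hx)
        exact IsUnit.of_mul_eq_one ⟨(x : F)⁻¹, hAB h⟩ (Subtype.ext (mul_inv_cancel₀ h0))
  refine ⟨⟨x, hxA⟩, (IsLocalRing.mem_maximalIdeal _).2 fun hu => ?_, rfl⟩
  exact (IsLocalRing.mem_maximalIdeal x).1 hx (hu.map (A.inclusion B hAB))

/-- Let `F` be a field and `A ⊆ B` valuation subrings of `F` (so `B` is
a coarsening of `A`).  If `A` is henselian, then so is `B`. -/
theorem henselian_of_coarsening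
    (F : Type*) [Field F] (A B : ValuationSubring F) (hAB : A ≤ B)
    (hA : HenselianLocalRing A) : HenselianLocalRing B := by
  refine { is_henselian := fun f _ a₀ h₀ h₁ => ?_ }
  obtain ⟨u, hu⟩ := h₁.exists_right_inv
  let t := Polynomial.taylor a₀ f
  have ht₀ : t.coeff 0 = f.eval a₀ := Polynomial.taylor_coeff_zero a₀ f
  have ht₁ : t.coeff 1 = f.derivative.eval a₀ := Polynomial.taylor_coeff_one a₀ f
  let e : ℕ → B := fun i => t.coeff (i + 2) * (-u) ^ (i + 2) * f.eval a₀ ^ (i + 1)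
  have he : ∀ i, e i ∈ IsLocalRing.maximalIdeal B := fun i =>
    Ideal.mul_mem_left _ _ (Ideal.pow_mem_of_mem _ h₀ _ i.succ_pos)
  choose d hd hde using fun i => ValuationSubring.exists_mem_maximalIdeal_of_le hAB (he i)
  obtain ⟨z, hz⟩ := HenselianLocalRing.exists_one_sub_add_sum_eq_zero t.natDegree d hd
  replace hz := congrArg (A.inclusion B hAB) hz
  simp only [map_add, map_sub, map_one, map_sum, map_mul, map_pow, map_zero, hde] at hz
  generalize A.inclusion B hAB z = z' at hz
  refine ⟨-u * f.eval a₀ * z' + a₀, ?_, ?_⟩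
  · have hsum : ∑ i ∈ Finset.range t.natDegree,
        t.coeff (i + 2) * (-u * f.eval a₀ * z') ^ (i + 2)
        = f.eval a₀ * ∑ i ∈ Finset.range t.natDegree, e i * z' ^ (i + 2) := by
      rw [Finset.mul_sum]
      refine Finset.sum_congr rfl fun i _ => ?_
      simp only [e, mul_pow]
      ring
    rw [Polynomial.IsRoot, ← Polynomial.taylor_eval,
      Polynomial.eval_eq_sum_range' (n := t.natDegree + 2) (by simp [t]),
      Finset.sum_range_succ', Finset.sum_range_succ']
    change ∑ i ∈ Finset.range t.natDegree, t.coeff (i + 2) * (-u * f.eval a₀ * z') ^ (i + 2)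
      + t.coeff 1 * (-u * f.eval a₀ * z') ^ 1 + t.coeff 0 * (-u * f.eval a₀ * z') ^ 0 = 0
    rw [hsum, ht₀, ht₁]
    linear_combination f.eval a₀ * hz - f.eval a₀ * z' * hu
  · rw [add_sub_cancel_right]
    exact Ideal.mul_mem_right _ _ (Ideal.mul_mem_left _ _ h₀)
end

section
/- Let p be a prime and k a finite field extension of ℚ_p, with valuation ring 𝒪_k (the integral closure of ℤ_p in k). Let L be a field extension of k and O a valuation subring of L such that: (i) O ∩ k = 𝒪_k; (ii) the extension is immediate in value groups, i.e., for every x ∈ L^× there exists a ∈ k^× with x·a^{-1} ∈ O^×; and (iii) the extension is immediate in residue fields, i.e., the induced map 𝒪_k/m_{𝒪_k} → O/m_O on residue fields is surjective. Then L = k. (In words: a finite extension of ℚ_p, being complete, admits no nontrivial immediate valued field extension.) -/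
/-- The integral closure of `ℤ_p` in a finite extension of `ℚ_p` is compact for any topology
making the extension a topological vector space over `ℚ_p`. -/
theorem PadicInt.isCompact_integralClosure
    (p : ℕ) [Fact p.Prime]
    (k : Type*) [Field k] [TopologicalSpace k] [ContinuousAdd k]
    [Algebra ℚ_[p] k] [ContinuousSMul ℚ_[p] k] [FiniteDimensional ℚ_[p] k]
    [Algebra ℤ_[p] k] [IsScalarTower ℤ_[p] ℚ_[p] k] :
    IsCompact (integralClosure ℤ_[p] k : Set k) := by
  have hfin : Module.Finite ℤ_[p] (integralClosure ℤ_[p] k) :=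
    IsIntegralClosure.finite ℤ_[p] ℚ_[p] k (integralClosure ℤ_[p] k)
  obtain ⟨n, f, hf⟩ := Module.Finite.exists_fin' ℤ_[p] (integralClosure ℤ_[p] k)
  have hsmul : ContinuousSMul ℤ_[p] k := ⟨by
    have h : (fun q : ℤ_[p] × k => q.1 • q.2) = fun q => (q.1 : ℚ_[p]) • q.2 := by
      ext q
      exact (algebraMap_smul ℚ_[p] q.1 q.2).symm
    rw [h]
    fun_prop⟩
  let g : (Fin n → ℤ_[p]) →ₗ[ℤ_[p]] k := (integralClosure ℤ_[p] k).val.toLinearMap ∘ₗ f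
  have hg : Continuous g := g.continuous_on_pi
  convert isCompact_range hg
  ext y
  constructor
  · intro hy
    obtain ⟨z, hz⟩ := hf ⟨y, hy⟩
    exact ⟨z, by simp [g, hz]⟩
  · rintro ⟨z, rfl⟩
    exact (f z).2

/-- If the integral closure of `ℤ_p` is cut out by `O`, then each ball of `L`, centred at a point of
`k` and with radius in the value group of `k`, meets `k` in a translate of a multiple of the
integral closure. -/
theorem ValuationSubring.setOf_valuation_sub_le_eq_image
    {k L : Type*} [Field k] [Field L] [Algebra k L] (O : ValuationSubring L) {S : Set k}
    (hS : ∀ x : k, algebraMap k L x ∈ O ↔ x ∈ S) (a : k) {b : k} (hb : b ≠ 0) :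
    {c : k | O.valuation (algebraMap k L (c - a)) ≤ O.valuation (algebraMap k L b)} =
      (fun y => a + b * y) '' S := by
  have hb' : O.valuation (algebraMap k L b) ≠ 0 := by simpa using hb
  ext c
  constructor
  · intro hc
    refine ⟨b⁻¹ * (c - a), ?_, by field_simp; ring⟩
    rw [← hS, ← O.valuation_le_one_iff, map_mul, map_mul, map_inv₀, map_inv₀, mul_comm,
      ← div_eq_mul_inv]
    exact div_le_one_of_le₀ hc zero_le
  · rintro ⟨y, hy, rfl⟩
    rw [← hS, ← O.valuation_le_one_iff] at hy
    simpa using mul_le_of_le_one_right' hy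

/-- Let `k/ℚ_p` be finite with valuation ring `𝒪_k` (the integral
closure of `ℤ_p` in `k`).  Let `L/k` be a field extension and `O` a valuation subring of
`L` such that `O ∩ k = 𝒪_k` and the extension `(L, O)/(k, 𝒪_k)` is immediate in value
groups and in residue fields.  Then `L = k`. -/
theorem eq_of_immediate_extension
    (p : ℕ) [Fact p.Prime]
    (k : Type) [Field k] [Algebra ℚ_[p] k] [FiniteDimensional ℚ_[p] k]
    [Algebra ℤ_[p] k] [IsScalarTower ℤ_[p] ℚ_[p] k]
    (L : Type) [Field L] [Algebra k L]
    (O : ValuationSubring L)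
    -- (i) `O ∩ k = 𝒪_k`
    (hOk : ∀ x : k, algebraMap k L x ∈ O ↔ x ∈ integralClosure ℤ_[p] k)
    -- (ii) the extension of value groups is immediate
    (hval : ∀ x : L, x ≠ 0 → ∃ a : k, a ≠ 0 ∧
      x * (algebraMap k L a)⁻¹ ∈ O ∧ (x * (algebraMap k L a)⁻¹)⁻¹ ∈ O)
    -- (iii) the extension of residue fields is immediate
    (hres : ∀ x : L, x ∈ O → ∃ a : k, a ∈ integralClosure ℤ_[p] k ∧
      x - algebraMap k L a ∈ O.nonunits) :
    Function.Surjective (algebraMap k L) := by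
  let _ : NormedField k := spectralNorm.normedField ℚ_[p] k
  let _ : NormedAlgebra ℚ_[p] k := spectralNorm.normedAlgebra ℚ_[p] k
  intro x
  by_contra! hx
  have hne (a : k) : x - algebraMap k L a ≠ 0 := sub_ne_zero.mpr (hx a).symm
  choose b hb0 hb hb' using fun a => hval _ (hne a)
  have hvb (a : k) : O.valuation (x - algebraMap k L a) = O.valuation (algebraMap k L (b a)) := by
    have h0 : O.valuation (algebraMap k L (b a)) ≠ 0 := by simpa using hb0 a
    have h1 := (O.valuation_le_one_iff _).mpr (hb a)
    have h2 := (O.valuation_le_one_iff _).mpr (hb' a)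
    rw [mul_inv_rev, inv_inv, map_mul, map_inv₀, ← div_eq_mul_inv,
      div_le_one₀ (zero_lt_iff.mpr (by simpa using hne a))] at h2
    rw [map_mul, map_inv₀, ← div_eq_mul_inv, div_le_one₀ (zero_lt_iff.mpr h0)] at h1
    exact le_antisymm h1 h2
  -- The points of `k` at least as close to `x` as `a` form a ball of `k`.
  let B (a : k) : Set k :=
    {c | O.valuation (x - algebraMap k L c) ≤ O.valuation (x - algebraMap k L a)}
  have mem_B (a c : k) : c ∈ B a ↔
      O.valuation (x - algebraMap k L c) ≤ O.valuation (x - algebraMap k L a) := Iff.rfl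
  have hB (a : k) : B a = (fun y => a + b a * y) '' (integralClosure ℤ_[p] k : Set k) := by
    rw [← O.setOf_valuation_sub_le_eq_image hOk a (hb0 a), ← hvb]
    ext c
    have h : x - algebraMap k L c = (x - algebraMap k L a) - algebraMap k L (c - a) := by
      rw [map_sub]; ring
    have h' : algebraMap k L (c - a) = (x - algebraMap k L a) - (x - algebraMap k L c) := by
      rw [map_sub]; ring
    constructor
    · intro hc
      rw [Set.mem_ofPred_eq, h']
      exact O.valuation.map_sub_le le_rfl hc
    · intro hc
      rw [mem_B, h]
      exact O.valuation.map_sub_le le_rfl hc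
  have hcomp (a : k) : IsCompact (B a) := by
    rw [hB]
    exact (PadicInt.isCompact_integralClosure p k).image (by fun_prop)
  obtain ⟨a, ha⟩ := IsCompact.nonempty_iInter_of_directed_nonempty_isCompact_isClosed B
    (fun a c => by
      rcases le_total (O.valuation (x - algebraMap k L a))
        (O.valuation (x - algebraMap k L c)) with h | h
      · exact ⟨a, subset_rfl, fun d hd => (mem_B _ d).mpr (((mem_B _ d).mp hd).trans h)⟩
      · exact ⟨c, fun d hd => (mem_B _ d).mpr (((mem_B _ d).mp hd).trans h), subset_rfl⟩)
    (fun a => ⟨a, (mem_B a a).mpr le_rfl⟩) hcomp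
    (fun a => (hcomp a).isClosed)
  -- Immediacy produces a point strictly closer to `x` than `a`.
  obtain ⟨c, -, hc⟩ := hres _ (hb a)
  have hba : algebraMap k L (b a) ≠ 0 := by simpa using hb0 a
  have hlt : O.valuation (x - algebraMap k L (a + b a * c)) <
      O.valuation (x - algebraMap k L a) := by
    have h : x - algebraMap k L (a + b a * c) = algebraMap k L (b a) *
        ((x - algebraMap k L a) * (algebraMap k L (b a))⁻¹ - algebraMap k L c) := by
      rw [map_add, map_mul]
      field_simp
      ring
    rw [h, map_mul, hvb]
    exact mul_lt_of_lt_one_right (zero_lt_iff.mpr (by simpa using hb0 a)) hc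
  exact ((mem_B _ a).mp (Set.mem_iInter.mp ha (a + b a * c))).not_gt hlt
end
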